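/- Let M ⊂ ℝ² be a compact convex set with 0 ∈ interior M, M = −M, such that M is strictly convex (its boundary contains no nondegenerate segment) and smooth (for every p ∈ frontier M there is a unique continuous linear functional φ with ‖φ‖ = 1 and φ(x) ≤ φ(p) for all x ∈ M). Let K ⊂ ℝ² be a convex body with centroid c = c(K). Then there exist at least four pairwise distinct points q ∈ frontier K with the following property: there is a nonzero continuous linear functional φ : ℝ² → ℝ such that φ(x) ≤ φ(q) for all x ∈ K and φ(x) ≤ φ(q) for all x ∈ c + gauge_M(q − c) • M. (This is Theorem 1.1 for a normed plane with smooth, strictly convex unit disk: the common support line of K and of the homothet of M centered at c through q is a support line of K Birkhoff orthogonal to the segment [c, q], so q is an equilibrium point of K in the norm with unit ball M.) -/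

import Mathlib

open MeasureTheory

/-- The centroid of a body `K` in the plane. -/
noncomputable def centroid (K : Set (EuclideanSpace ℝ (Fin 2))) : EuclideanSpace ℝ (Fin 2) :=
  (volume K).toReal⁻¹ • ∫ x in K, x

/-- `q` is an equilibrium point of `K` with respect to the norm with unit ball `M`:
some nonzero linear functional supports `K` at `q` and also supports the homothet
of `M` centered at the centroid `c` and passing through `q`. -/
def IsNormedEquilibriumPoint (M K : Set (EuclideanSpace ℝ (Fin 2)))
    (q : EuclideanSpace ℝ (Fin 2)) : Prop :=
  q ∈ frontier K ∧
    ∃ φ : EuclideanSpace ℝ (Fin 2) →L[ℝ] ℝ, φ ≠ 0 ∧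
      (∀ x ∈ K, φ x ≤ φ q) ∧
      (∀ x ∈ M, φ (centroid K + gauge M (q - centroid K) • x) ≤ φ q)

open Set Filter Topology

section Gauge

variable {E : Type*} [NormedAddCommGroup E] [NormedSpace ℝ E]

lemma gauge_pos_of_isCompact {A : Set E} (hA : IsCompact A) (h0 : A ∈ 𝓝 0) {x : E} (hx : x ≠ 0) :
    0 < gauge A x :=
  (gauge_pos (absorbent_nhds_zero h0) (hA.isVonNBounded ℝ)).2 hx

lemma exists_support_gauge {A : Set E} (hA : Convex ℝ A) (h0 : A ∈ 𝓝 0) {y : E}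
    (hy : 0 < gauge A y) :
    ∃ φ : E →L[ℝ] ℝ, φ ≠ 0 ∧ ∀ x, gauge A x ≤ gauge A y → φ x ≤ φ y := by
  have hconv : Convex ℝ {x | gauge A x < gauge A y} := by
    intro a ha b hb s t hs ht hst
    have h := gauge_add_le hA (absorbent_nhds_zero h0) (s • a) (t • b)
    rw [gauge_smul_of_nonneg hs, gauge_smul_of_nonneg ht] at h
    exact h.trans_lt (convex_Iio (gauge A y) ha hb hs ht hst)
  obtain ⟨φ, hφ⟩ := geometric_hahn_banach_open_point hconv
    (isOpen_Iio.preimage (continuous_gauge hA h0)) (x := y) (lt_irrefl (gauge A y))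
  have hφy : 0 < φ y := by simpa using hφ 0 (by simpa using hy)
  refine ⟨φ, fun h => by simp [h] at hφy, fun x hx => ?_⟩
  by_contra! hlt
  have hx0 : 0 < φ x := hφy.trans hlt
  have ht : 0 ≤ φ y / φ x := by positivity
  have ht1 : φ y / φ x < 1 := (div_lt_one hx0).2 hlt
  have := hφ ((φ y / φ x) • x) (by
    simp only [mem_ofPred_eq, gauge_smul_of_nonneg ht, smul_eq_mul]
    nlinarith [gauge_nonneg (s := A) x])
  rw [map_smul, smul_eq_mul, div_mul_cancel₀ _ hx0.ne'] at this
  exact lt_irrefl _ this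

lemma exists_common_support {A B : Set E} (hA : Convex ℝ A) (hA0 : A ∈ 𝓝 0) (hB : Convex ℝ B)
    (hB0 : B ∈ 𝓝 0) {y : E} (hAy : 0 < gauge A y) (hBy : 0 < gauge B y)
    (h : IsLocalMax (fun z => gauge A z / gauge B z) y) :
    ∃ φ : E →L[ℝ] ℝ, φ ≠ 0 ∧ (∀ x, gauge A x ≤ gauge A y → φ x ≤ φ y) ∧
      ∀ x, gauge B x ≤ gauge B y → φ x ≤ φ y := by
  obtain ⟨φ, hφ0, hφ⟩ := exists_support_gauge hA hA0 hAy
  refine ⟨φ, hφ0, hφ, fun x hx => ?_⟩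
  have hpath : Tendsto (fun t : ℝ => (1 - t) • y + t • x) (𝓝[>] 0) (𝓝 y) := by
    have : Continuous (fun t : ℝ => (1 - t) • y + t • x) := by fun_prop
    simpa using (this.tendsto 0).mono_left nhdsWithin_le_nhds
  have hBpos : ∀ᶠ z in 𝓝 y, 0 < gauge B z :=
    (continuous_gauge hB hB0).continuousAt.eventually (lt_mem_nhds hBy)
  obtain ⟨t, ⟨ht, htpos⟩, ht0, ht1⟩ :=
    ((hpath.eventually (h.and hBpos)).and (Ioo_mem_nhdsGT one_pos)).exists
  have hz : gauge B ((1 - t) • y + t • x) ≤ gauge B y := by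
    refine (gauge_add_le hB (absorbent_nhds_zero hB0) _ _).trans ?_
    rw [gauge_smul_of_nonneg ht0.le, gauge_smul_of_nonneg (sub_nonneg.2 ht1.le), smul_eq_mul,
      smul_eq_mul]
    nlinarith
  have := hφ ((1 - t) • y + t • x) (by
    rw [div_le_div_iff₀ htpos hBy] at ht
    nlinarith)
  simp only [map_add, map_smul, smul_eq_mul] at this
  nlinarith

end Gauge

section Polar

/-- The unit vector with polar angle `θ`. -/
noncomputable def planeDir (θ : ℝ) : EuclideanSpace ℝ (Fin 2) := !₂[Real.cos θ, Real.sin θ]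

/-- The plane rotated by `-θ` and identified with `ℂ`. -/
noncomputable def planeRot (θ : ℝ) (z : EuclideanSpace ℝ (Fin 2)) : ℂ :=
  ⟨Real.cos θ * z 0 + Real.sin θ * z 1, Real.cos θ * z 1 - Real.sin θ * z 0⟩

lemma continuous_planeDir : Continuous planeDir := by
  unfold planeDir
  fun_prop

lemma continuous_planeRot (θ : ℝ) : Continuous (planeRot θ) := by
  have : planeRot θ = fun z : EuclideanSpace ℝ (Fin 2) => Complex.equivRealProdCLM.symm
      (Real.cos θ * z 0 + Real.sin θ * z 1, Real.cos θ * z 1 - Real.sin θ * z 0) := by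
    rfl
  rw [this]
  fun_prop

lemma planeDir_add_two_pi (θ : ℝ) : planeDir (θ + 2 * Real.pi) = planeDir θ := by
  simp [planeDir]

lemma planeDir_add_pi (θ : ℝ) : planeDir (θ + Real.pi) = -planeDir θ := by
  ext i; fin_cases i <;> simp [planeDir]

lemma norm_planeDir (θ : ℝ) : ‖planeDir θ‖ = 1 := by
  simp [planeDir, EuclideanSpace.norm_eq]

lemma planeDir_ne_zero (θ : ℝ) : planeDir θ ≠ 0 := by
  intro h
  simpa [h] using norm_planeDir θ

lemma planeDir_ne {s t : ℝ} (h0 : s < t) (h1 : t < s + 2 * Real.pi) :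
    planeDir s ≠ planeDir t := by
  intro h
  have hc : Real.cos s = Real.cos t := congrArg (fun z : EuclideanSpace ℝ (Fin 2) => z 0) h
  have hs : Real.sin s = Real.sin t := congrArg (fun z : EuclideanSpace ℝ (Fin 2) => z 1) h
  have : Real.cos (t - s) = 1 := by
    rw [Real.cos_sub, hc, hs]
    nlinarith [Real.cos_sq_add_sin_sq t]
  have := (Real.cos_eq_one_iff_of_lt_of_lt (by linarith [Real.pi_pos]) (by linarith)).1 this
  linarith

lemma planeRot_polar (θ : ℝ) (z : EuclideanSpace ℝ (Fin 2)) :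
    z = ‖planeRot θ z‖ • planeDir (θ + (planeRot θ z).arg) := by
  have h1 := Complex.norm_mul_cos_arg (planeRot θ z)
  have h2 := Complex.norm_mul_sin_arg (planeRot θ z)
  have h3 := Real.cos_sq_add_sin_sq θ
  have hre : (planeRot θ z).re = Real.cos θ * z 0 + Real.sin θ * z 1 := rfl
  have him : (planeRot θ z).im = Real.cos θ * z 1 - Real.sin θ * z 0 := rfl
  ext i
  fin_cases i
  · simp only [planeDir, Fin.zero_eta, PiLp.smul_apply, smul_eq_mul, Matrix.cons_val_zero,
      Real.cos_add]
    linear_combination (-z 0) * h3 - Real.cos θ * h1 + Real.sin θ * h2 - Real.cos θ * hre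
      + Real.sin θ * him
  · simp only [planeDir, Fin.mk_one, PiLp.smul_apply, smul_eq_mul, Matrix.cons_val_one,
      Matrix.cons_val_zero, Real.sin_add]
    linear_combination (-z 1) * h3 - Real.sin θ * h1 - Real.cos θ * h2 - Real.sin θ * hre
      - Real.cos θ * him

lemma planeRot_smul_planeDir (θ t : ℝ) : planeRot θ (t • planeDir θ) = t := by
  apply Complex.ext
  · simp only [planeRot, planeDir, PiLp.smul_apply, smul_eq_mul, Matrix.cons_val_zero,
      Matrix.cons_val_one, Complex.ofReal_re]
    linear_combination t * Real.cos_sq_add_sin_sq θ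
  · simp only [planeRot, planeDir, PiLp.smul_apply, smul_eq_mul, Matrix.cons_val_zero,
      Matrix.cons_val_one, Complex.ofReal_im]
    ring

lemma eventually_polar {F : EuclideanSpace ℝ (Fin 2) → ℝ}
    (hF : ∀ t : ℝ, 0 < t → ∀ z, F (t • z) = F z) {θ : ℝ}
    {p : ℝ → Prop} (h : ∀ᶠ s in 𝓝 θ, p (F (planeDir s))) {t : ℝ} (ht : 0 < t) :
    ∀ᶠ z in 𝓝 (t • planeDir θ), p (F z) := by
  have hr := planeRot_smul_planeDir θ t
  have hslit : planeRot θ (t • planeDir θ) ∈ Complex.slitPlane := by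
    rw [hr]; exact Complex.ofReal_mem_slitPlane.2 ht
  have hc : ContinuousAt (fun z => θ + (planeRot θ z).arg) (t • planeDir θ) :=
    continuousAt_const.add
      ((Complex.continuousAt_arg hslit).comp (continuous_planeRot θ).continuousAt)
  have hval : θ + (planeRot θ (t • planeDir θ)).arg = θ := by
    rw [hr, Complex.arg_ofReal_of_nonneg ht.le, add_zero]
  have hc' : Tendsto (fun z => θ + (planeRot θ z).arg) (𝓝 (t • planeDir θ)) (𝓝 θ) := by
    simpa only [ContinuousAt, hval] using hc
  have hne : ∀ᶠ z in 𝓝 (t • planeDir θ), z ≠ 0 :=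
    isOpen_ne.mem_nhds (smul_ne_zero ht.ne' (planeDir_ne_zero θ))
  filter_upwards [hc'.eventually h, hne] with z hz hz0
  have hpol := planeRot_polar θ z
  have hpos : 0 < ‖planeRot θ z‖ := by
    refine (norm_nonneg _).lt_of_ne fun h0 => hz0 ?_
    rw [hpol, ← h0, zero_smul]
  rw [hpol, hF _ hpos]
  exact hz

end Polar

section Circle

/-- Four local extrema of `f` with pairwise distinct directions. -/
def HasFourLocalExtr (f : ℝ → ℝ) : Prop :=
  ∃ t₁ t₂ t₃ t₄ : ℝ,
    planeDir t₁ ≠ planeDir t₂ ∧ planeDir t₁ ≠ planeDir t₃ ∧ planeDir t₁ ≠ planeDir t₄ ∧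
    planeDir t₂ ≠ planeDir t₃ ∧ planeDir t₂ ≠ planeDir t₄ ∧ planeDir t₃ ≠ planeDir t₄ ∧
    IsLocalExtr f t₁ ∧ IsLocalExtr f t₂ ∧ IsLocalExtr f t₃ ∧ IsLocalExtr f t₄

lemma exists_isLocalMax_Ioo {f : ℝ → ℝ} (hf : Continuous f) {a b c : ℝ} (hc : c ∈ Ioo a b)
    (ha : f a < f c) (hb : f b < f c) : ∃ m ∈ Ioo a b, IsLocalMax f m ∧ f c ≤ f m := by
  obtain ⟨m, hm, hmax⟩ := isCompact_Icc.exists_isMaxOn ⟨c, Ioo_subset_Icc_self hc⟩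
    hf.continuousOn (s := Icc a b)
  have hcm : f c ≤ f m := hmax (Ioo_subset_Icc_self hc)
  have hm' : m ∈ Ioo a b := by
    refine ⟨hm.1.lt_of_ne ?_, hm.2.lt_of_ne ?_⟩
    · rintro rfl; linarith
    · rintro rfl; linarith
  exact ⟨m, hm', hmax.isLocalMax (Icc_mem_nhds hm'.1 hm'.2), hcm⟩

lemma exists_isLocalMin_Ioo {f : ℝ → ℝ} (hf : Continuous f) {a b c : ℝ} (hc : c ∈ Ioo a b)
    (ha : f c < f a) (hb : f c < f b) : ∃ m ∈ Ioo a b, IsLocalMin f m ∧ f m ≤ f c := by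
  obtain ⟨m, hm, hmin, hle⟩ := exists_isLocalMax_Ioo hf.neg hc (neg_lt_neg ha) (neg_lt_neg hb)
  exact ⟨m, hm, by simpa using hmin.neg, neg_le_neg_iff.1 hle⟩

lemma hasFourLocalExtr_of_alternating {F : EuclideanSpace ℝ (Fin 2) → ℝ}
    (hF : Continuous (F ∘ planeDir)) {a b c d : ℝ} (hab : a < b) (hbc : b < c) (hcd : c < d)
    (hda : d < a + 2 * Real.pi)
    (h1 : F (planeDir b) < F (planeDir a)) (h2 : F (planeDir d) < F (planeDir a))
    (h3 : F (planeDir b) < F (planeDir c)) (h4 : F (planeDir d) < F (planeDir c)) :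
    HasFourLocalExtr (F ∘ planeDir) := by
  have hper (s : ℝ) : F (planeDir (s - 2 * Real.pi)) = F (planeDir s) := by
    rw [← planeDir_add_two_pi, sub_add_cancel]
  obtain ⟨m₁, hm₁, e₁, v₁⟩ := exists_isLocalMax_Ioo hF (a := d - 2 * Real.pi) (b := b) (c := a)
    ⟨by linarith, hab⟩ (by simpa [hper] using h2) h1
  obtain ⟨m₂, hm₂, e₂, v₂⟩ := exists_isLocalMax_Ioo hF (a := b) (b := d) (c := c)
    ⟨hbc, hcd⟩ h3 h4
  obtain ⟨n₁, hn₁, e₃, v₃⟩ := exists_isLocalMin_Ioo hF (a := a) (b := c) (c := b)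
    ⟨hab, hbc⟩ h1 h3
  obtain ⟨n₂, hn₂, e₄, v₄⟩ := exists_isLocalMin_Ioo hF (a := c) (b := a + 2 * Real.pi) (c := d)
    ⟨hcd, hda⟩ h4 (by simpa [planeDir_add_two_pi] using h2)
  simp only [Function.comp_apply, mem_Ioo] at *
  refine ⟨m₁, m₂, n₁, n₂, planeDir_ne (by linarith) (by linarith), ?_, ?_, ?_, ?_,
    planeDir_ne (by linarith) (by linarith), Or.inr e₁, Or.inr e₂, Or.inl e₃, Or.inl e₄⟩
  all_goals
    intro h
    have := congrArg F h
    linarith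

lemma hasFourLocalExtr_of_eqOn_Ioo {f : ℝ → ℝ} {a r : ℝ}
    (h : ∀ x ∈ Ioo a (a + Real.pi), f x = r) : HasFourLocalExtr f := by
  have hpi := Real.pi_pos
  have key : ∀ x ∈ Ioo a (a + Real.pi), IsLocalExtr f x := fun x hx => Or.inl <| by
    filter_upwards [Ioo_mem_nhds hx.1 hx.2] with y hy
    rw [h x hx, h y hy]
  refine ⟨a + Real.pi / 5, a + 2 * Real.pi / 5, a + 3 * Real.pi / 5, a + 4 * Real.pi / 5,
    planeDir_ne ?_ ?_, planeDir_ne ?_ ?_, planeDir_ne ?_ ?_, planeDir_ne ?_ ?_,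
    planeDir_ne ?_ ?_, planeDir_ne ?_ ?_, key _ ⟨?_, ?_⟩, key _ ⟨?_, ?_⟩, key _ ⟨?_, ?_⟩,
    key _ ⟨?_, ?_⟩⟩
  all_goals linarith

lemma hasFourLocalExtr_or_exists_halves {F : EuclideanSpace ℝ (Fin 2) → ℝ}
    (hF : Continuous (F ∘ planeDir)) :
    HasFourLocalExtr (F ∘ planeDir) ∨ ∃ θ r : ℝ,
      (∀ s ∈ Icc θ (θ + Real.pi), r ≤ F (planeDir s)) ∧
      (∀ s ∈ Icc θ (θ + Real.pi), F (-planeDir s) ≤ r) ∧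
      ∃ s ∈ Ioo θ (θ + Real.pi), r < F (planeDir s) := by
  have hpi := Real.pi_pos
  obtain ⟨θ, hθ⟩ : ∃ θ, F (planeDir (θ + Real.pi)) = F (planeDir θ) := by
    have hg : Continuous fun s => F (planeDir (s + Real.pi)) - F (planeDir s) :=
      (hF.comp (continuous_add_const Real.pi)).sub hF
    have hanti : F (planeDir (0 + Real.pi + Real.pi)) - F (planeDir (0 + Real.pi)) =
        -(F (planeDir (0 + Real.pi)) - F (planeDir 0)) := by
      rw [planeDir_add_pi (0 + Real.pi), planeDir_add_pi 0, neg_neg]; ring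
    have : (0 : ℝ) ∈ range fun s => F (planeDir (s + Real.pi)) - F (planeDir s) := by
      rcases le_total (F (planeDir (0 + Real.pi)) - F (planeDir 0)) 0 with h | h
      · exact mem_range_of_exists_le_of_exists_ge hg ⟨0, h⟩ ⟨0 + Real.pi, by linarith⟩
      · exact mem_range_of_exists_le_of_exists_ge hg ⟨0 + Real.pi, by linarith⟩ ⟨0, h⟩
    obtain ⟨θ, h⟩ := this
    exact ⟨θ, by simpa [sub_eq_zero] using h⟩
  set r := F (planeDir θ) with hr
  by_contra! hcon
  obtain ⟨hno, hhalf⟩ := hcon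
  have h2pi : F (planeDir (θ + 2 * Real.pi)) = r := by rw [planeDir_add_two_pi]
  have hup : (∀ s ∈ Ioo θ (θ + Real.pi), F (planeDir s) ≤ r) ∨
      ∀ s ∈ Ioo θ (θ + Real.pi), F (-planeDir s) ≤ r := by
    by_contra! h
    obtain ⟨⟨p, hp, hp'⟩, q, hq, hq'⟩ := h
    rw [← planeDir_add_pi] at hq'
    exact hno (hasFourLocalExtr_of_alternating hF (a := p) (b := θ + Real.pi)
      (c := q + Real.pi) (d := θ + 2 * Real.pi) hp.2 (by linarith [hq.1]) (by linarith [hq.2])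
      (by linarith [hp.1]) (by linarith) (by linarith) (by linarith) (by linarith))
  have hlo : (∀ s ∈ Ioo θ (θ + Real.pi), r ≤ F (planeDir s)) ∨
      ∀ s ∈ Ioo θ (θ + Real.pi), r ≤ F (-planeDir s) := by
    by_contra! h
    obtain ⟨⟨p, hp, hp'⟩, q, hq, hq'⟩ := h
    rw [← planeDir_add_pi] at hq'
    exact hno (hasFourLocalExtr_of_alternating hF (a := θ) (b := p)
      (c := θ + Real.pi) (d := q + Real.pi) hp.1 hp.2 (by linarith [hq.1])
      (by linarith [hq.2]) (by linarith) (by linarith) (by linarith) (by linarith))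
  have hneg : F (-planeDir θ) = r := by rw [← planeDir_add_pi, hθ]
  have hend : ∀ {p : ℝ → Prop}, p θ → p (θ + Real.pi) → (∀ s ∈ Ioo θ (θ + Real.pi), p s) →
      ∀ s ∈ Icc θ (θ + Real.pi), p s := by
    intro p h1 h2 h s hs
    rcases hs.1.eq_or_lt with rfl | h3
    · exact h1
    rcases hs.2.eq_or_lt with rfl | h4
    · exact h2
    exact h s ⟨h3, h4⟩
  have hnegpi : F (-planeDir (θ + Real.pi)) = r := by rw [planeDir_add_pi, neg_neg]
  rcases hup with hup | hup <;> rcases hlo with hlo | hlo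
  · exact hno (hasFourLocalExtr_of_eqOn_Ioo (a := θ) (r := r)
      fun s hs => le_antisymm (hup s hs) (hlo s hs))
  · have hup' := hend (p := fun s => F (planeDir s) ≤ r) hr.ge hθ.le hup
    have hlo' := hend (p := fun s => r ≤ F (-planeDir s)) hneg.ge hnegpi.ge hlo
    have hshift : ∀ s, planeDir s = -planeDir (s - Real.pi) := fun s => by
      rw [← planeDir_add_pi, sub_add_cancel]
    have h := hhalf (θ + Real.pi) r
      (fun s hs => by
        rw [hshift]; exact hlo' _ ⟨by linarith [hs.1], by linarith [hs.2]⟩)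
      (fun s hs => by
        rw [hshift, neg_neg]; exact hup' _ ⟨by linarith [hs.1], by linarith [hs.2]⟩)
    refine hno (hasFourLocalExtr_of_eqOn_Ioo (a := θ + Real.pi) (r := r)
      fun s hs => le_antisymm (h s hs) ?_)
    rw [Function.comp_apply, hshift]
    exact hlo' _ ⟨by linarith [hs.1], by linarith [hs.2]⟩
  · have hup' := hend (p := fun s => F (-planeDir s) ≤ r) hneg.le hnegpi.le hup
    have hlo' := hend (p := fun s => r ≤ F (planeDir s)) hr.le hθ.ge hlo
    exact hno (hasFourLocalExtr_of_eqOn_Ioo (a := θ) (r := r)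
      fun s hs => le_antisymm (hhalf θ r hlo' hup' s hs) (hlo s hs))
  · refine hno (hasFourLocalExtr_of_eqOn_Ioo (a := θ + Real.pi) (r := r) fun s hs => ?_)
    have hs' : s - Real.pi ∈ Ioo θ (θ + Real.pi) := ⟨by linarith [hs.1], by linarith [hs.2]⟩
    have : planeDir s = -planeDir (s - Real.pi) := by rw [← planeDir_add_pi, sub_add_cancel]
    rw [Function.comp_apply, this]
    exact le_antisymm (hup _ hs') (hlo _ hs')

end Circle

section Centroid

lemma integral_pos_of_pos_on_isOpen {X : Type*} [TopologicalSpace X] [MeasurableSpace X]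
    {μ : Measure X} [μ.IsOpenPosMeasure] {f : X → ℝ} (hf : Integrable f μ) (h0 : ∀ x, 0 ≤ f x)
    {U : Set X} (hU : IsOpen U) (hne : U.Nonempty) (hpos : ∀ x ∈ U, 0 < f x) :
    0 < ∫ x, f x ∂μ :=
  (integral_pos_iff_support_of_nonneg h0 hf).2
    ((hU.measure_pos μ hne).trans_le (measure_mono fun x hx => (hpos x hx).ne'))

variable {K : Set (EuclideanSpace ℝ (Fin 2))}

lemma setIntegral_sub_centroid (hK : IsCompact K) (hint : (interior K).Nonempty)
    (φ : EuclideanSpace ℝ (Fin 2) →L[ℝ] ℝ) : ∫ x in K, φ (x - centroid K) = 0 := by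
  have hvol : (volume K).toReal ≠ 0 := by
    refine ENNReal.toReal_ne_zero.2 ⟨?_, hK.measure_lt_top.ne⟩
    exact ((isOpen_interior.measure_pos volume hint).trans_le (measure_mono interior_subset)).ne'
  have hid : IntegrableOn (fun x : EuclideanSpace ℝ (Fin 2) => x) K :=
    continuous_id.continuousOn.integrableOn_compact hK
  have hconst : IntegrableOn (fun _ : EuclideanSpace ℝ (Fin 2) => centroid K) K :=
    continuous_const.continuousOn.integrableOn_compact hK
  have h := ContinuousLinearMap.integral_comp_comm φ (hid.sub hconst)
  simp only [Pi.sub_apply] at h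
  rw [h, integral_sub hid hconst, setIntegral_const, centroid, Measure.real, smul_inv_smul₀ hvol,
    sub_self, map_zero]

lemma centroid_mem_interior (hK : IsCompact K) (hconv : Convex ℝ K)
    (hint : (interior K).Nonempty) : centroid K ∈ interior K := by
  by_contra hc
  obtain ⟨φ, hφ⟩ := geometric_hahn_banach_open_point hconv.interior isOpen_interior hc
  have hle : ∀ x ∈ K, φ x ≤ φ (centroid K) := by
    intro x hx
    have hx' : x ∈ closure (interior K) := by
      rw [hconv.closure_interior_eq_closure_of_nonempty_interior hint]
      exact subset_closure hx
    exact closure_minimal (fun y hy => (hφ y hy).le)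
      (isClosed_le φ.continuous continuous_const) hx'
  have hcont : Continuous fun x => (-φ) (x - centroid K) := by fun_prop
  have hpos : 0 < ∫ x, K.indicator (fun x => (-φ) (x - centroid K)) x := by
    refine integral_pos_of_pos_on_isOpen
      ((integrable_indicator_iff hK.measurableSet).2 (hcont.continuousOn.integrableOn_compact hK))
      (fun x => indicator_nonneg (fun y hy => ?_) x) isOpen_interior hint fun x hx => ?_
    · simpa using hle y hy
    · rw [indicator_of_mem (interior_subset hx)]
      simpa using hφ x hx
  rw [integral_indicator hK.measurableSet, setIntegral_sub_centroid hK hint] at hpos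
  exact lt_irrefl _ hpos

lemma setIntegral_preimage_centroid_add (hK : IsCompact K) (hint : (interior K).Nonempty)
    (φ : EuclideanSpace ℝ (Fin 2) →L[ℝ] ℝ) : ∫ x in (centroid K + ·) ⁻¹' K, φ x = 0 := by
  have hmeas : MeasurableSet ((centroid K + ·) ⁻¹' K) :=
    (continuous_const_add (centroid K)).measurable hK.measurableSet
  rw [← setIntegral_sub_centroid hK hint φ, ← integral_indicator hmeas,
    ← integral_indicator hK.measurableSet,
    ← integral_add_left_eq_self (K.indicator _) (centroid K)]
  congr 1 with x
  by_cases hx : centroid K + x ∈ K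
  · rw [indicator_of_mem hx, indicator_of_mem (mem_preimage.2 hx), add_sub_cancel_left]
  · rw [indicator_of_notMem hx, indicator_of_notMem (by simpa using hx)]

end Centroid

section Halves

open scoped Pointwise

variable {A B : Set (EuclideanSpace ℝ (Fin 2))}

lemma not_halves (hA : IsCompact A) (hAc : Convex ℝ A) (hA0 : A ∈ 𝓝 0) (hsymm : A = -A)
    (hB : IsCompact B) (hBc : Convex ℝ B) (hB0 : B ∈ 𝓝 0)
    (hint : ∀ φ : EuclideanSpace ℝ (Fin 2) →L[ℝ] ℝ, ∫ x in B, φ x = 0) {θ r : ℝ}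
    (hge : ∀ s ∈ Icc θ (θ + Real.pi), r ≤ gauge A (planeDir s) / gauge B (planeDir s))
    (hle : ∀ s ∈ Icc θ (θ + Real.pi), gauge A (-planeDir s) / gauge B (-planeDir s) ≤ r)
    (hlt : ∃ s ∈ Ioo θ (θ + Real.pi), r < gauge A (planeDir s) / gauge B (planeDir s)) :
    False := by
  have hApos {x} := gauge_pos_of_isCompact hA hA0 (x := x)
  have hBpos {x} := gauge_pos_of_isCompact hB hB0 (x := x)
  have hr : 0 < r := by
    have hne : -planeDir θ ≠ 0 := neg_ne_zero.2 (planeDir_ne_zero θ)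
    exact (div_pos (hApos hne) (hBpos hne)).trans_le
      (hle θ ⟨le_rfl, by linarith [Real.pi_pos]⟩)
  have hmemB (x) : x ∈ B ↔ gauge B x ≤ 1 := by
    rw [gauge_le_one_iff_mem_closure hBc hB0, hB.isClosed.closure_eq]
  have hmemC (x) : x ∈ r • A ↔ gauge A x ≤ r := by
    have hmemA (z) : z ∈ A ↔ gauge A z ≤ 1 := by
      rw [gauge_le_one_iff_mem_closure hAc hA0, hA.isClosed.closure_eq]
    rw [mem_smul_set_iff_inv_smul_mem₀ hr.ne', hmemA, gauge_smul_of_nonneg (inv_nonneg.2 hr.le),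
      smul_eq_mul, inv_mul_le_iff₀ hr, mul_one]
  have hgneg (x) : gauge A (-x) = gauge A x :=
    gauge_neg (fun y hy => by rw [hsymm] at hy; exact hy) x
  set φ : EuclideanSpace ℝ (Fin 2) →L[ℝ] ℝ :=
    Real.cos (θ + Real.pi / 2) • EuclideanSpace.proj 0 +
      Real.sin (θ + Real.pi / 2) • EuclideanSpace.proj 1 with hφdef
  have hφ (x) : φ x = (planeRot (θ + Real.pi / 2) x).re := by simp [hφdef, planeRot]
  have hφdir (s) : φ (planeDir s) = Real.sin (s - θ) := by
    simp [hφdef, planeDir, Real.cos_add_pi_div_two, Real.sin_add_pi_div_two, Real.sin_sub]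
    ring
  have hpolar : ∀ x, x ≠ 0 → 0 ≤ φ x → ∃ ρ : ℝ, 0 < ρ ∧ ∃ s ∈ Icc θ (θ + Real.pi),
      x = ρ • planeDir s := by
    intro x hx h
    have hpol := planeRot_polar (θ + Real.pi / 2) x
    refine ⟨_, (norm_nonneg _).lt_of_ne fun h0 => hx ?_, _, ?_, hpol⟩
    · rw [hpol, ← h0, zero_smul]
    · rw [hφ, ← Complex.abs_arg_le_pi_div_two_iff, abs_le] at h
      constructor <;> linarith
  have hCB : ∀ x, 0 ≤ φ x → x ∈ r • A → x ∈ B := by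
    intro x h hx
    by_cases hx0 : x = 0
    · rw [hx0]; exact mem_of_mem_nhds hB0
    obtain ⟨ρ, hρ, s, hs, rfl⟩ := hpolar x hx0 h
    have := hge s hs
    rw [hmemC, gauge_smul_of_nonneg hρ.le, smul_eq_mul] at hx
    rw [hmemB, gauge_smul_of_nonneg hρ.le, smul_eq_mul]
    rw [le_div_iff₀ (hBpos (planeDir_ne_zero s))] at this
    have h1 := mul_le_mul_of_nonneg_left this hρ.le
    have h2 : r * (ρ * gauge B (planeDir s)) ≤ r * 1 := by linarith
    exact le_of_mul_le_mul_left h2 hr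
  have hBC : ∀ x, φ x ≤ 0 → x ∈ B → x ∈ r • A := by
    intro x h hx
    by_cases hx0 : x = 0
    · rw [hmemC, hx0, gauge_zero]; exact hr.le
    obtain ⟨ρ, hρ, s, hs, hxs⟩ := hpolar (-x) (neg_ne_zero.2 hx0) (by simpa using h)
    obtain rfl : x = ρ • -planeDir s := by rw [smul_neg, ← hxs, neg_neg]
    have := hle s hs
    rw [hmemB, gauge_smul_of_nonneg hρ.le, smul_eq_mul] at hx
    rw [hmemC, gauge_smul_of_nonneg hρ.le, smul_eq_mul]
    rw [div_le_iff₀ (hBpos (neg_ne_zero.2 (planeDir_ne_zero s)))] at this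
    have h1 := mul_le_mul_of_nonneg_left this hρ.le
    nlinarith
  have hCcomp : IsCompact (r • A) := hA.smul r
  have hintB : Integrable (B.indicator φ) := (integrable_indicator_iff hB.measurableSet).2
    (φ.continuous.continuousOn.integrableOn_compact hB)
  have hintC : Integrable ((r • A).indicator φ) :=
    (integrable_indicator_iff hCcomp.measurableSet).2
      (φ.continuous.continuousOn.integrableOn_compact hCcomp)
  have hzeroC : ∫ x, (r • A).indicator φ x = 0 := by
    have hodd : ∀ x, (r • A).indicator φ (-x) = -(r • A).indicator φ x := by
      intro x
      have hiff : -x ∈ r • A ↔ x ∈ r • A := by rw [hmemC, hmemC, hgneg]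
      by_cases hx : x ∈ r • A
      · rw [indicator_of_mem hx, indicator_of_mem (hiff.2 hx), map_neg]
      · rw [indicator_of_notMem hx, indicator_of_notMem (mt hiff.1 hx), neg_zero]
    have h := integral_neg_eq_self ((r • A).indicator φ) volume
    simp only [hodd, integral_neg] at h
    linarith
  obtain ⟨s, hs, hsr⟩ := hlt
  have ha := hApos (planeDir_ne_zero s)
  have hb := hBpos (planeDir_ne_zero s)
  have hopen : IsOpen {x | gauge B x < 1 ∧ r < gauge A x ∧ 0 < φ x} :=
    (isOpen_lt (continuous_gauge hBc hB0) continuous_const).inter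
      ((isOpen_lt continuous_const (continuous_gauge hAc hA0)).inter
        (isOpen_lt continuous_const φ.continuous))
  have hne : {x | gauge B x < 1 ∧ r < gauge A x ∧ 0 < φ x}.Nonempty := by
    rw [lt_div_iff₀ hb] at hsr
    have : r / gauge A (planeDir s) < 1 / gauge B (planeDir s) := by
      rw [div_lt_div_iff₀ ha hb]; linarith
    obtain ⟨t, ht1, ht2⟩ := exists_between this
    have ht : 0 < t := (div_pos hr ha).trans ht1
    refine ⟨t • planeDir s, ?_, ?_, ?_⟩
    · rw [gauge_smul_of_nonneg ht.le, smul_eq_mul]; exact (lt_div_iff₀ hb).1 ht2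
    · rw [gauge_smul_of_nonneg ht.le, smul_eq_mul]; exact (div_lt_iff₀ ha).1 ht1
    · rw [map_smul, hφdir, smul_eq_mul]
      exact mul_pos ht (Real.sin_pos_of_pos_of_lt_pi (by linarith [hs.1]) (by linarith [hs.2]))
  have hpos : 0 < ∫ x, (B.indicator φ x - (r • A).indicator φ x) := by
    refine integral_pos_of_pos_on_isOpen (hintB.sub hintC) (fun x => ?_) hopen hne
      fun x ⟨h1, h2, h3⟩ => ?_
    · rcases le_total 0 (φ x) with h | h
      · by_cases hx : x ∈ r • A
        · rw [indicator_of_mem hx, indicator_of_mem (hCB x h hx), sub_self]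
        · rw [indicator_of_notMem hx, sub_zero]
          exact indicator_apply_nonneg fun _ => h
      · by_cases hx : x ∈ B
        · rw [indicator_of_mem hx, indicator_of_mem (hBC x h hx), sub_self]
        · rw [indicator_of_notMem hx, zero_sub, neg_nonneg]
          exact indicator_apply_le' (fun _ => h) fun _ => le_rfl
    · rw [indicator_of_mem ((hmemB x).2 h1.le),
        indicator_of_notMem (fun h => absurd ((hmemC x).1 h) h2.not_ge), sub_zero]
      exact h3
  rw [integral_sub hintB hintC, hzeroC, integral_indicator hB.measurableSet, hint,
    sub_zero] at hpos
  exact lt_irrefl _ hpos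

end Halves

section Equilibrium

variable {M K : Set (EuclideanSpace ℝ (Fin 2))}

/-- The boundary point of `K` seen from its centroid in direction `θ`. -/
noncomputable def radialPoint (K : Set (EuclideanSpace ℝ (Fin 2))) (θ : ℝ) :
    EuclideanSpace ℝ (Fin 2) :=
  centroid K + (gauge ((centroid K + ·) ⁻¹' K) (planeDir θ))⁻¹ • planeDir θ

lemma planeDir_eq_of_radialPoint_eq
    (hpos : ∀ θ, 0 < gauge ((centroid K + ·) ⁻¹' K) (planeDir θ)) {s t : ℝ}
    (h : radialPoint K s = radialPoint K t) : planeDir s = planeDir t := by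
  have h' := add_left_cancel h
  have hn := congrArg norm h'
  rw [norm_smul, norm_smul, norm_planeDir, norm_planeDir, mul_one, mul_one,
    Real.norm_of_nonneg (inv_pos.2 (hpos s)).le, Real.norm_of_nonneg (inv_pos.2 (hpos t)).le] at hn
  rw [hn] at h'
  exact smul_right_injective _ (inv_pos.2 (hpos t)).ne' h'

lemma isNormedEquilibriumPoint_radialPoint (hM : IsCompact M) (hMc : Convex ℝ M) (hM0 : M ∈ 𝓝 0)
    (hB : IsCompact ((centroid K + ·) ⁻¹' K)) (hBc : Convex ℝ ((centroid K + ·) ⁻¹' K))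
    (hB0 : (centroid K + ·) ⁻¹' K ∈ 𝓝 0) {θ : ℝ}
    (h : IsLocalExtr
      ((fun z => gauge M z / gauge ((centroid K + ·) ⁻¹' K) z) ∘ planeDir) θ) :
    IsNormedEquilibriumPoint M K (radialPoint K θ) := by
  set B := (centroid K + ·) ⁻¹' K with hBdef
  have hb : 0 < gauge B (planeDir θ) := gauge_pos_of_isCompact hB hB0 (planeDir_ne_zero θ)
  set t := (gauge B (planeDir θ))⁻¹ with ht
  have htpos : 0 < t := inv_pos.2 hb
  set y := t • planeDir θ with hy
  have hyne : y ≠ 0 := smul_ne_zero htpos.ne' (planeDir_ne_zero θ)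
  have hBy : gauge B y = 1 := by
    rw [hy, gauge_smul_of_nonneg htpos.le, smul_eq_mul, ht, inv_mul_cancel₀ hb.ne']
  have hMpos := gauge_pos_of_isCompact hM hM0 hyne
  have hBpos := gauge_pos_of_isCompact hB hB0 hyne
  have hhom : ∀ C D : Set (EuclideanSpace ℝ (Fin 2)), ∀ u : ℝ, 0 < u → ∀ z,
      gauge C (u • z) / gauge D (u • z) = gauge C z / gauge D z := by
    intro C D u hu z
    rw [gauge_smul_of_nonneg hu.le, gauge_smul_of_nonneg hu.le, smul_eq_mul, smul_eq_mul,
      mul_div_mul_left _ _ hu.ne']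
  obtain ⟨φ, hφ0, hφM, hφB⟩ : ∃ φ : EuclideanSpace ℝ (Fin 2) →L[ℝ] ℝ, φ ≠ 0 ∧
      (∀ x, gauge M x ≤ gauge M y → φ x ≤ φ y) ∧ ∀ x, gauge B x ≤ gauge B y → φ x ≤ φ y := by
    rcases h with h | h
    · have hmin := eventually_polar
        (F := fun z => gauge M z / gauge B z) (hhom M B)
        (p := fun v => gauge M (planeDir θ) / gauge B (planeDir θ) ≤ v) h htpos
      have hmax : IsLocalMax (fun z => gauge B z / gauge M z) y := by
        filter_upwards [hmin] with z hz
        rw [← hhom M B t htpos (planeDir θ)] at hz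
        have := inv_anti₀ (div_pos hMpos hBpos) hz
        rwa [inv_div, inv_div] at this
      obtain ⟨φ, h0, h1, h2⟩ := exists_common_support hBc hB0 hMc hM0 hBpos hMpos hmax
      exact ⟨φ, h0, h2, h1⟩
    · refine exists_common_support hMc hM0 hBc hB0 hMpos hBpos ?_
      have hmax := eventually_polar
        (F := fun z => gauge M z / gauge B z) (hhom M B)
        (p := fun v => v ≤ gauge M (planeDir θ) / gauge B (planeDir θ)) h htpos
      filter_upwards [hmax] with z hz
      rwa [← hhom M B t htpos (planeDir θ)] at hz
  have hq : radialPoint K θ = centroid K + y := rfl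
  have hfront : y ∈ frontier B := (gauge_eq_one_iff_mem_frontier hBc hB0).1 hBy
  refine ⟨?_, φ, hφ0, fun x hx => ?_, fun x hx => ?_⟩
  · rw [hq]
    have := (Homeomorph.addLeft (centroid K)).preimage_frontier K
    rw [hBdef] at hfront
    exact this.symm.subset hfront
  · have := hφB (x - centroid K) (by
      rw [hBy]
      exact gauge_le_one_of_mem (by simpa [hBdef] using hx))
    rw [hq, map_add]
    rw [map_sub] at this
    linarith
  · rw [hq, add_sub_cancel_left, map_add, map_add, add_le_add_iff_left]
    refine hφM _ ?_
    rw [gauge_smul_of_nonneg hMpos.le, smul_eq_mul]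
    exact mul_le_of_le_one_right hMpos.le (gauge_le_one_of_mem hx)

end Equilibrium

/-- Every convex body in a normed plane with smooth, strictly convex unit disk has at least
four equilibrium points. -/
theorem stmt_1 (M : Set (EuclideanSpace ℝ (Fin 2)))
    (hM_compact : IsCompact M) (hM_conv : Convex ℝ M)
    (hM_zero : (0:EuclideanSpace ℝ (Fin 2)) ∈ interior M)
    (hM_symm : M = -M)
    (hM_strict : StrictConvex ℝ M)
    (hM_smooth : ∀ p ∈ frontier M,
      ∃! φ : EuclideanSpace ℝ (Fin 2) →L[ℝ] ℝ, ‖φ‖ = 1 ∧ ∀ x ∈ M, φ x ≤ φ p)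
    (K : Set (EuclideanSpace ℝ (Fin 2)))
    (hK_compact : IsCompact K) (hK_conv : Convex ℝ K)
    (hK_int : (interior K).Nonempty) :
    ∃ q₁ q₂ q₃ q₄ : EuclideanSpace ℝ (Fin 2),
      q₁ ≠ q₂ ∧ q₁ ≠ q₃ ∧ q₁ ≠ q₄ ∧ q₂ ≠ q₃ ∧ q₂ ≠ q₄ ∧ q₃ ≠ q₄ ∧
      IsNormedEquilibriumPoint M K q₁ ∧ IsNormedEquilibriumPoint M K q₂ ∧
      IsNormedEquilibriumPoint M K q₃ ∧ IsNormedEquilibriumPoint M K q₄ := by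
  set B := (centroid K + ·) ⁻¹' K with hBdef
  have hM0 : M ∈ 𝓝 0 := mem_interior_iff_mem_nhds.1 hM_zero
  have hB : IsCompact B := (Homeomorph.addLeft (centroid K)).isCompact_preimage.2 hK_compact
  have hBc : Convex ℝ B := hK_conv.translate_preimage_right (centroid K)
  have hB0 : B ∈ 𝓝 0 := by
    refine (continuous_const_add (centroid K)).continuousAt.preimage_mem_nhds ?_
    rw [add_zero]
    exact mem_interior_iff_mem_nhds.1 (centroid_mem_interior hK_compact hK_conv hK_int)
  have hpos : ∀ θ, 0 < gauge B (planeDir θ) := fun θ =>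
    gauge_pos_of_isCompact hB hB0 (planeDir_ne_zero θ)
  have hcont : Continuous ((fun z => gauge M z / gauge B z) ∘ planeDir) :=
    ((continuous_gauge hM_conv hM0).comp continuous_planeDir).div
      ((continuous_gauge hBc hB0).comp continuous_planeDir) fun θ => (hpos θ).ne'
  rcases hasFourLocalExtr_or_exists_halves hcont with h | ⟨θ, r, h1, h2, h3⟩
  · obtain ⟨t₁, t₂, t₃, t₄, n₁, n₂, n₃, n₄, n₅, n₆, e₁, e₂, e₃, e₄⟩ := h
    have hne {s t : ℝ} (h : planeDir s ≠ planeDir t) : radialPoint K s ≠ radialPoint K t :=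
      mt (planeDir_eq_of_radialPoint_eq hpos) h
    have heq {s : ℝ} (h : IsLocalExtr ((fun z => gauge M z / gauge B z) ∘ planeDir) s) :
        IsNormedEquilibriumPoint M K (radialPoint K s) :=
      isNormedEquilibriumPoint_radialPoint hM_compact hM_conv hM0 hB hBc hB0 h
    exact ⟨_, _, _, _, hne n₁, hne n₂, hne n₃, hne n₄, hne n₅, hne n₆, heq e₁, heq e₂, heq e₃,
      heq e₄⟩
  · exact (not_halves hM_compact hM_conv hM0 hM_symm hB hBc hB0
      (setIntegral_preimage_centroid_add hK_compact hK_int) h1 h2 h3).elim
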